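/- arXiv:2307.02597 — 5 statements merged into one kernel-verified Lean document; each statement's English description precedes it below -/
import Mathlib

section
/- Let a < b be real numbers, let α₁, α₂, β₁, β₂ ∈ ℝ, and let f : [a,b] × ℝ → ℝ be continuous, bounded above by a constant M ∈ ℝ (i.e., f(x,y) ≤ M for all (x,y) ∈ [a,b] × ℝ), and nonincreasing in its second argument (i.e., y₁ ≥ y₂ implies f(x,y₁) ≤ f(x,y₂) for all x ∈ [a,b]). Then there exists a four-times continuously differentiable function w : [a,b] → ℝ satisfying w⁗(x) = f(x, w(x)) for all x ∈ [a,b], together with the boundary conditions w(a) = α₁, w(b) = α₂, w''(a) = β₁, w''(b) = β₂. -/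
open Set

/-- A continuous midpoint-convex perturbation of `½‖z‖²` which is bounded below on a Hilbert space
attains its minimum. -/
theorem exists_isMinOn_half_norm_sq_add {H : Type*} [NormedAddCommGroup H] [InnerProductSpace ℝ H]
    [CompleteSpace H] (Φ : H → ℝ) (hcont : Continuous Φ)
    (hconv : ∀ u v, Φ ((1 / 2 : ℝ) • (u + v)) ≤ (Φ u + Φ v) / 2)
    (hbdd : BddBelow (range fun z => ‖z‖ ^ 2 / 2 + Φ z)) :
    ∃ z, ∀ y, ‖z‖ ^ 2 / 2 + Φ z ≤ ‖y‖ ^ 2 / 2 + Φ y := by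
  set J : H → ℝ := fun z => ‖z‖ ^ 2 / 2 + Φ z with hJ
  have hJle : ∀ z, sInf (range J) ≤ J z := fun z => csInf_le hbdd ⟨z, rfl⟩
  have happrox : ∀ n : ℕ, ∃ z, J z < sInf (range J) + 1 / ((n : ℝ) + 1) := fun n => by
    obtain ⟨_, ⟨z, rfl⟩, hz⟩ := exists_lt_of_csInf_lt (range_nonempty J)
      (lt_add_of_pos_right (sInf (range J)) (Nat.one_div_pos_of_nat (α := ℝ) (n := n)))
    exact ⟨z, hz⟩
  choose z hz using happrox
  have hdist : ∀ u v, ‖u - v‖ ^ 2 ≤ 4 * (J u + J v) - 8 * sInf (range J) := fun u v => by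
    have h1 := hJle ((1 / 2 : ℝ) • (u + v))
    have h2 := hconv u v
    have h3 := parallelogram_law_with_norm ℝ u v
    simp only [hJ, norm_smul, mul_pow] at h1 ⊢
    norm_num at h1 h2
    linarith
  have hlim := tendsto_one_div_add_atTop_nhds_zero_nat (𝕜 := ℝ)
  have hcauchy : CauchySeq z := by
    refine cauchySeq_of_le_tendsto_0 (fun n => √(8 * (1 / ((n : ℝ) + 1)))) ?_ ?_
    · intro n m N hn hm
      rw [dist_eq_norm]
      refine Real.le_sqrt_of_sq_le ?_
      have hn' := Nat.one_div_le_one_div (α := ℝ) hn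
      have hm' := Nat.one_div_le_one_div (α := ℝ) hm
      linarith [hdist (z n) (z m), hz n, hz m]
    · have h := (Real.continuous_sqrt.tendsto _).comp (hlim.const_mul 8)
      rwa [mul_zero, Real.sqrt_zero] at h
  obtain ⟨x, hx⟩ := cauchySeq_tendsto_of_complete hcauchy
  refine ⟨x, fun y => (?_ : J x ≤ sInf (range J)).trans (hJle y)⟩
  have hJcont : Continuous J := by fun_prop
  refine le_of_tendsto_of_tendsto' ((hJcont.tendsto x).comp hx) ?_ (fun n => (hz n).le)
  simpa using hlim.const_add (sInf (range J))

open scoped RealInnerProductSpace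

/-- For an antitone continuous `g`, the increments of a primitive lie below its tangent lines. -/
theorem Antitone.intervalIntegral_le_mul_sub {g : ℝ → ℝ} (hg : Continuous g) (hanti : Antitone g)
    (m y : ℝ) : ∫ t in m..y, g t ≤ g m * (y - m) := by
  rcases le_total m y with h | h
  · have := intervalIntegral.integral_mono_on (μ := MeasureTheory.volume) h
      (hg.intervalIntegrable _ _) (intervalIntegrable_const (c := g m)) fun t ht => hanti ht.1
    simpa [mul_comm] using this
  · have := intervalIntegral.integral_mono_on (μ := MeasureTheory.volume) h
      (intervalIntegrable_const (c := g m)) (hg.intervalIntegrable _ _) fun t ht => hanti ht.2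
    rw [intervalIntegral.integral_symm]
    simp only [intervalIntegral.integral_const, smul_eq_mul] at this
    linarith

/-- A Hammerstein equation with antitone nonlinearity and positive semidefinite kernel
`⟪κ x, κ y⟫` is solvable, in weak form. -/
theorem exists_forall_inner_eq_intervalIntegral {H : Type*} [NormedAddCommGroup H]
    [InnerProductSpace ℝ H] [CompleteSpace H] {a b : ℝ} (hab : a ≤ b) {κ : ℝ → H}
    (hκ : Continuous κ) {g : ℝ → ℝ → ℝ} (hg : Continuous (Function.uncurry g))
    (hanti : ∀ x, Antitone (g x)) :
    ∃ z, ∀ φ, ⟪z, φ⟫ = ∫ x in a..b, g x ⟪κ x, z⟫ * ⟪κ x, φ⟫ := by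
  set F : ℝ → ℝ → ℝ := fun x y => ∫ t in (0 : ℝ)..y, g x t with hF
  have hFcont : Continuous (Function.uncurry F) :=
    intervalIntegral.continuous_parametric_primitive_of_continuous hg
  have hgx : ∀ x, Continuous (g x) := fun x => by fun_prop
  have htangent : ∀ x m y, F x y ≤ F x m + g x m * (y - m) := fun x m y => by
    have h1 := (hanti x).intervalIntegral_le_mul_sub (hgx x) m y
    have h2 := intervalIntegral.integral_add_adjacent_intervals (μ := MeasureTheory.volume)
      ((hgx x).intervalIntegrable 0 m) ((hgx x).intervalIntegrable m y)
    simp only [hF]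
    linarith
  have hFκ : ∀ z, Continuous fun x => F x ⟪κ x, z⟫ := fun z =>
    hFcont.comp (by fun_prop : Continuous fun x => (x, ⟪κ x, z⟫))
  have hgκ : ∀ z, Continuous fun x => g x ⟪κ x, z⟫ := fun z =>
    hg.comp (by fun_prop : Continuous fun x => (x, ⟪κ x, z⟫))
  set Φ : H → ℝ := fun z => -∫ x in a..b, F x ⟪κ x, z⟫ with hΦ
  have hΦcont : Continuous Φ := by
    refine (intervalIntegral.continuous_parametric_intervalIntegral_of_continuous' ?_ a b).neg
    exact hFcont.comp (by fun_prop : Continuous fun p : H × ℝ => (p.2, ⟪κ p.2, p.1⟫))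
  have hΦconv : ∀ u v, Φ ((1 / 2 : ℝ) • (u + v)) ≤ (Φ u + Φ v) / 2 := fun u v => by
    have key : ∫ x in a..b, (F x ⟪κ x, u⟫ + F x ⟪κ x, v⟫) ≤
        ∫ x in a..b, 2 * F x ⟪κ x, (1 / 2 : ℝ) • (u + v)⟫ := by
      refine intervalIntegral.integral_mono_on hab
        (((hFκ u).add (hFκ v)).intervalIntegrable _ _)
        (((hFκ _).const_mul 2).intervalIntegrable _ _) fun x _ => ?_
      have h1 := htangent x ⟪κ x, (1 / 2 : ℝ) • (u + v)⟫ ⟪κ x, u⟫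
      have h2 := htangent x ⟪κ x, (1 / 2 : ℝ) • (u + v)⟫ ⟪κ x, v⟫
      have h3 : ⟪κ x, (1 / 2 : ℝ) • (u + v)⟫ = (⟪κ x, u⟫ + ⟪κ x, v⟫) / 2 := by
        rw [inner_smul_right, inner_add_right]; ring
      rw [h3] at h1 h2 ⊢
      linarith
    rw [intervalIntegral.integral_add ((hFκ u).intervalIntegrable _ _)
      ((hFκ v).intervalIntegrable _ _), intervalIntegral.integral_const_mul] at key
    simp only [hΦ]
    linarith
  have hbdd : BddBelow (range fun z => ‖z‖ ^ 2 / 2 + Φ z) := by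
    set B := ∫ x in a..b, |g x 0| * ‖κ x‖ with hB
    refine ⟨-B ^ 2 / 2, ?_⟩
    rintro _ ⟨z, rfl⟩
    have hgκ_cont : Continuous fun x => |g x 0| * ‖κ x‖ := by fun_prop
    have key : ∫ x in a..b, F x ⟪κ x, z⟫ ≤ ∫ x in a..b, |g x 0| * ‖κ x‖ * ‖z‖ := by
      refine intervalIntegral.integral_mono_on hab ((hFκ z).intervalIntegrable _ _)
        ((hgκ_cont.mul_const _).intervalIntegrable _ _) fun x _ => ?_
      calc F x ⟪κ x, z⟫ ≤ F x 0 + g x 0 * (⟪κ x, z⟫ - 0) := htangent x 0 _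
        _ = g x 0 * ⟪κ x, z⟫ := by simp [hF]
        _ ≤ |g x 0| * |⟪κ x, z⟫| := (le_abs_self _).trans (abs_mul _ _).le
        _ ≤ |g x 0| * (‖κ x‖ * ‖z‖) := by gcongr; exact abs_real_inner_le_norm _ _
        _ = _ := by ring
    rw [intervalIntegral.integral_mul_const] at key
    simp only [hΦ]
    nlinarith [sq_nonneg (‖z‖ - B)]
  obtain ⟨z, hz⟩ := exists_isMinOn_half_norm_sq_add Φ hΦcont hΦconv hbdd
  have hle : ∀ φ, ∫ x in a..b, g x ⟪κ x, z⟫ * ⟪κ x, φ⟫ ≤ ⟪z, φ⟫ := fun φ => by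
    set I : ℝ → ℝ := fun t => ∫ x in a..b, g x ⟪κ x, z + t • φ⟫ * ⟪κ x, φ⟫ with hI
    have hIcont : Continuous I := by
      refine intervalIntegral.continuous_parametric_intervalIntegral_of_continuous' ?_ a b
      exact (hg.comp (by fun_prop : Continuous fun p : ℝ × ℝ =>
        (p.2, ⟪κ p.2, z + p.1 • φ⟫))).mul (by fun_prop)
    have hpos : ∀ t > 0, I t ≤ ⟪z, φ⟫ + t / 2 * ‖φ‖ ^ 2 := fun t ht => by
      have hprod : Continuous fun x => t * (g x ⟪κ x, z + t • φ⟫ * ⟪κ x, φ⟫) :=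
        ((hgκ _).mul (by fun_prop)).const_mul t
      have key : ∫ x in a..b, F x ⟪κ x, z⟫ ≤ ∫ x in a..b, (F x ⟪κ x, z + t • φ⟫ -
          t * (g x ⟪κ x, z + t • φ⟫ * ⟪κ x, φ⟫)) := by
        refine intervalIntegral.integral_mono_on hab ((hFκ z).intervalIntegrable _ _)
          (((hFκ _).sub hprod).intervalIntegrable _ _)
          fun x _ => (htangent x ⟪κ x, z + t • φ⟫ ⟪κ x, z⟫).trans_eq ?_
        rw [inner_add_right, inner_smul_right]
        ring
      rw [intervalIntegral.integral_sub ((hFκ _).intervalIntegrable _ _)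
        (hprod.intervalIntegrable _ _), intervalIntegral.integral_const_mul] at key
      have hmin := hz (z + t • φ)
      have hnorm : ‖z + t • φ‖ ^ 2 = ‖z‖ ^ 2 + 2 * (t * ⟪z, φ⟫) + t ^ 2 * ‖φ‖ ^ 2 := by
        rw [norm_add_sq_real, inner_smul_right, norm_smul, mul_pow, Real.norm_eq_abs, sq_abs]
      rw [hnorm] at hmin
      simp only [hΦ] at hmin
      refine le_of_mul_le_mul_left (a := t) ?_ ht
      simp only [hI]
      linarith
    have h0 : I 0 ≤ ⟪z, φ⟫ + 0 / 2 * ‖φ‖ ^ 2 := by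
      refine le_of_tendsto_of_tendsto
        (hIcont.continuousWithinAt (s := Ioi 0) (x := 0))
        ((by fun_prop : Continuous fun t : ℝ => ⟪z, φ⟫ + t / 2 * ‖φ‖ ^ 2).continuousWithinAt
          (s := Ioi 0) (x := 0)) ?_
      filter_upwards [self_mem_nhdsWithin] with t ht using hpos t ht
    simpa [hI] using h0
  refine ⟨z, fun φ => le_antisymm ?_ (hle φ)⟩
  have h := hle (-φ)
  simp only [inner_neg_right, mul_neg, intervalIntegral.integral_neg] at h
  linarith

/-- The solution operator of `-u'' = v`, `u a = u b = 0`. -/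
noncomputable def dirichletSolution (a b : ℝ) (v : ℝ → ℝ) (y : ℝ) : ℝ :=
  ((b - y) * (∫ s in a..y, (s - a) * v s) + (y - a) * ∫ s in y..b, (b - s) * v s) / (b - a)

/-- The derivative of `dirichletSolution a b v`. -/
noncomputable def dirichletSolutionDeriv (a b : ℝ) (v : ℝ → ℝ) (y : ℝ) : ℝ :=
  ((∫ s in y..b, (b - s) * v s) - ∫ s in a..y, (s - a) * v s) / (b - a)

/-- The Green function of `-u''` on `[a,b]` with Dirichlet boundary conditions. -/
noncomputable def dirichletKernel (a b x s : ℝ) : ℝ := (min x s - a) * (b - max x s) / (b - a)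

section
variable {a b : ℝ} {v : ℝ → ℝ}

theorem hasDerivAt_integral_left (hv : Continuous v) (y : ℝ) :
    HasDerivAt (fun y => ∫ s in a..y, (s - a) * v s) ((y - a) * v y) y :=
  (by fun_prop : Continuous fun s => (s - a) * v s).deriv_integral .. ▸
    (intervalIntegral.differentiable_integral_of_continuous (by fun_prop) y).hasDerivAt

theorem hasDerivAt_integral_right (hv : Continuous v) (y : ℝ) :
    HasDerivAt (fun y => ∫ s in y..b, (b - s) * v s) (-((b - y) * v y)) y := by
  have hc : Continuous fun s => (b - s) * v s := by fun_prop
  exact intervalIntegral.integral_hasDerivAt_left (hc.intervalIntegrable _ _)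
    (hc.stronglyMeasurableAtFilter _ _) hc.continuousAt

theorem hasDerivAt_dirichletSolution (hv : Continuous v) (y : ℝ) :
    HasDerivAt (dirichletSolution a b v) (dirichletSolutionDeriv a b v y) y := by
  have h := ((((hasDerivAt_id y).const_sub b).mul (hasDerivAt_integral_left (a := a) hv y)).add
    (((hasDerivAt_id y).sub_const a).mul (hasDerivAt_integral_right (b := b) hv y))).div_const
      (b - a)
  refine h.congr_deriv ?_
  simp only [dirichletSolutionDeriv, id]
  ring

theorem hasDerivAt_dirichletSolutionDeriv (hab : a < b) (hv : Continuous v) (y : ℝ) :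
    HasDerivAt (dirichletSolutionDeriv a b v) (-v y) y := by
  have h := ((hasDerivAt_integral_right (b := b) hv y).sub
    (hasDerivAt_integral_left (a := a) hv y)).div_const (b - a)
  refine h.congr_deriv ?_
  have : b - a ≠ 0 := (sub_pos.2 hab).ne'
  field_simp
  ring

theorem continuous_dirichletSolution (hv : Continuous v) : Continuous (dirichletSolution a b v) :=
  continuous_iff_continuousAt.2 fun y => (hasDerivAt_dirichletSolution hv y).continuousAt

theorem dirichletSolution_left : dirichletSolution a b v a = 0 := by
  simp [dirichletSolution]

theorem dirichletSolution_right : dirichletSolution a b v b = 0 := by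
  simp [dirichletSolution]

theorem continuous_dirichletKernel : Continuous (Function.uncurry (dirichletKernel a b)) := by
  unfold dirichletKernel Function.uncurry
  fun_prop

theorem integral_dirichletKernel_mul (hv : Continuous v) {y : ℝ} (hy : y ∈ Icc a b) :
    ∫ s in a..b, dirichletKernel a b y s * v s = dirichletSolution a b v y := by
  have hc : Continuous fun s => dirichletKernel a b y s * v s := by
    unfold dirichletKernel
    fun_prop
  have h1 : ∫ s in a..y, dirichletKernel a b y s * v s =
      ∫ s in a..y, (b - y) / (b - a) * ((s - a) * v s) := by
    refine intervalIntegral.integral_congr fun s hs => ?_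
    rw [uIcc_of_le hy.1] at hs
    simp only [dirichletKernel, min_eq_right hs.2, max_eq_left hs.2]
    ring
  have h2 : ∫ s in y..b, dirichletKernel a b y s * v s =
      ∫ s in y..b, (y - a) / (b - a) * ((b - s) * v s) := by
    refine intervalIntegral.integral_congr fun s hs => ?_
    rw [uIcc_of_le hy.2] at hs
    simp only [dirichletKernel, min_eq_left hs.1, max_eq_right hs.1]
    ring
  rw [← intervalIntegral.integral_add_adjacent_intervals (hc.intervalIntegrable a y)
    (hc.intervalIntegrable y b), h1, h2, intervalIntegral.integral_const_mul,
    intervalIntegral.integral_const_mul, dirichletSolution]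
  ring

end

open MeasureTheory in
/-- A continuous kernel `k` factors `∫ k x s * k y s` as an inner product in `L²(a,b)`. -/
theorem exists_feature_map {a b : ℝ} (hab : a ≤ b) {k : ℝ → ℝ → ℝ}
    (hk : Continuous (Function.uncurry k)) :
    ∃ κ : ℝ → Lp ℝ 2 (volume.comap ((↑) : Icc a b → ℝ)), Continuous κ ∧
      ∀ x y, inner ℝ (κ x) (κ y) = ∫ s in a..b, k x s * k y s := by
  have : IsFiniteMeasure (volume.comap ((↑) : Icc a b → ℝ)) := by
    refine ⟨?_⟩
    rw [comap_subtype_coe_apply measurableSet_Icc]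
    simpa only [Subtype.coe_image_univ, image_univ, Subtype.range_coe] using measure_Icc_lt_top
  let K : C(ℝ × Icc a b, ℝ) := ⟨fun p => k p.1 p.2,
    hk.comp (by fun_prop : Continuous fun p : ℝ × Icc a b => (p.1, (p.2 : ℝ)))⟩
  refine ⟨fun x => ContinuousMap.toLp 2 _ ℝ (K.curry x), by fun_prop, fun x y => ?_⟩
  rw [ContinuousMap.inner_toLp, intervalIntegral.integral_of_le hab,
    ← integral_Icc_eq_integral_Ioc, ← integral_subtype_comap measurableSet_Icc]
  refine integral_congr_ae (.of_forall fun s => ?_)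
  exact mul_comm (k y s) (k x s)

theorem contDiff_four_of_hasDerivAt {w w₁ w₂ w₃ w₄ : ℝ → ℝ} (h₁ : ∀ x, HasDerivAt w (w₁ x) x)
    (h₂ : ∀ x, HasDerivAt w₁ (w₂ x) x) (h₃ : ∀ x, HasDerivAt w₂ (w₃ x) x)
    (h₄ : ∀ x, HasDerivAt w₃ (w₄ x) x) (hw₄ : Continuous w₄) :
    ContDiff ℝ 4 w ∧ iteratedDeriv 2 w = w₂ ∧ iteratedDeriv 4 w = w₄ := by
  have e₁ : deriv w = w₁ := deriv_eq h₁
  have e₂ : deriv w₁ = w₂ := deriv_eq h₂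
  have e₃ : deriv w₂ = w₃ := deriv_eq h₃
  have e₄ : deriv w₃ = w₄ := deriv_eq h₄
  have step : ∀ {u u' : ℝ → ℝ} {n : ℕ}, (∀ x, HasDerivAt u (u' x) x) → ContDiff ℝ n u' →
      ContDiff ℝ (n + 1 : ℕ) u := fun {u u' n} hu hu' => by
    push_cast
    exact contDiff_succ_iff_deriv.2 ⟨fun x => (hu x).differentiableAt, by simp,
      (deriv_eq hu).symm ▸ hu'⟩
  refine ⟨step h₁ (step h₂ (step h₃ (step (n := 0) h₄ (contDiff_zero.2 hw₄)))),
    ?_, ?_⟩ <;>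
  simp [iteratedDeriv_eq_iterate, Function.iterate_succ, e₁, e₂, e₃, e₄]

/-- The Hammerstein equation for the squared Dirichlet Green operator. -/
theorem exists_eq_dirichletSolution_dirichletSolution {a b : ℝ} (hab : a ≤ b) {g : ℝ → ℝ → ℝ}
    (hg : Continuous (Function.uncurry g)) (hanti : ∀ x, Antitone (g x)) :
    ∃ u : ℝ → ℝ, Continuous u ∧ ∀ y ∈ Icc a b,
      u y = dirichletSolution a b (dirichletSolution a b fun x => g x (u x)) y := by
  have hk := continuous_dirichletKernel (a := a) (b := b)
  obtain ⟨κ, hκ, hinner⟩ := exists_feature_map hab hk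
  obtain ⟨z, hz⟩ := exists_forall_inner_eq_intervalIntegral hab hκ hg hanti
  have hu : Continuous fun x => inner ℝ (κ x) z := by fun_prop
  refine ⟨fun x => inner ℝ (κ x) z, hu, fun y hy => ?_⟩
  set h : ℝ → ℝ := fun x => g x (inner ℝ (κ x) z) with hh
  have hcont : Continuous h := hg.comp (by fun_prop : Continuous fun x => (x, inner ℝ (κ x) z))
  have hsymm : ∀ x s, dirichletKernel a b x s = dirichletKernel a b s x := fun x s => by
    simp only [dirichletKernel, min_comm, max_comm]
  have hswap : ∫ x in a..b, ∫ s in a..b,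
        h x * (dirichletKernel a b x s * dirichletKernel a b y s) =
      ∫ s in a..b, ∫ x in a..b, h x * (dirichletKernel a b x s * dirichletKernel a b y s) := by
    refine MeasureTheory.intervalIntegral_intervalIntegral_swap ?_
    refine (ContinuousOn.integrableOn_compact (isCompact_uIcc.prod isCompact_uIcc)
      (Continuous.continuousOn ?_)).mono_set (prod_mono uIoc_subset_uIcc uIoc_subset_uIcc)
    exact (hcont.comp continuous_fst).mul (hk.mul
      (hk.comp (by fun_prop : Continuous fun q : ℝ × ℝ => (y, q.2))))
  calc inner ℝ (κ y) z = ∫ x in a..b, h x * inner ℝ (κ x) (κ y) := by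
        rw [real_inner_comm, hz]
    _ = ∫ x in a..b, ∫ s in a..b,
        h x * (dirichletKernel a b x s * dirichletKernel a b y s) := by
        simp only [hinner, intervalIntegral.integral_const_mul]
    _ = ∫ s in a..b, dirichletKernel a b y s * dirichletSolution a b h s := by
        rw [hswap]
        refine intervalIntegral.integral_congr fun s hs => ?_
        rw [uIcc_of_le hab] at hs
        simp only [← integral_dirichletKernel_mul hcont hs, hsymm s]
        rw [← intervalIntegral.integral_const_mul]
        exact intervalIntegral.integral_congr fun x _ => by ring
    _ = _ := integral_dirichletKernel_mul (continuous_dirichletSolution hcont) hy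

/-- **Existence** for the Euler–Bernoulli fourth-order BVP `w⁗ = f(x,w)` on `[a,b]`
with boundary conditions `w a = α₁`, `w b = α₂`, `w'' a = β₁`, `w'' b = β₂`,
when `f` is continuous, bounded above by `M`, and nonincreasing in its second argument. -/
theorem bvp_existence (a b : ℝ) (hab : a < b) (α₁ α₂ β₁ β₂ M : ℝ)
    (f : ℝ → ℝ → ℝ)
    (hf_cont : ContinuousOn (fun p : ℝ × ℝ => f p.1 p.2) (Set.Icc a b ×ˢ Set.univ))
    (hf_bdd : ∀ x ∈ Set.Icc a b, ∀ y : ℝ, f x y ≤ M)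
    (hf_mono : ∀ x ∈ Set.Icc a b, ∀ y₁ y₂ : ℝ, y₂ ≤ y₁ → f x y₁ ≤ f x y₂) :
    ∃ w : ℝ → ℝ, ContDiffOn ℝ 4 w (Set.Icc a b) ∧
      (∀ x ∈ Set.Icc a b, iteratedDerivWithin 4 w (Set.Icc a b) x = f x (w x)) ∧
      w a = α₁ ∧ w b = α₂ ∧
      iteratedDerivWithin 2 w (Set.Icc a b) a = β₁ ∧
      iteratedDerivWithin 2 w (Set.Icc a b) b = β₂ := by
  set ℓ : ℝ → ℝ → ℝ → ℝ := fun c d y => (c * (b - y) + d * (y - a)) / (b - a) with hℓ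
  have hba : b - a ≠ 0 := (sub_pos.2 hab).ne'
  have hℓ_deriv : ∀ c d y, HasDerivAt (ℓ c d) ((d - c) / (b - a)) y := fun c d y =>
    (((((hasDerivAt_id y).const_sub b).const_mul c).add
      (((hasDerivAt_id y).sub_const a).const_mul d)).div_const (b - a)).congr_deriv (by ring)
  have hℓ_left : ∀ c d, ℓ c d a = c := fun c d => by simp [hℓ, hba]
  have hℓ_right : ∀ c d, ℓ c d b = d := fun c d => by simp [hℓ, hba]
  have hℓ_cont : ∀ c d, Continuous (ℓ c d) := fun c d => by fun_prop
  set p : ℝ → ℝ := fun y => ℓ α₁ α₂ y - dirichletSolution a b (ℓ β₁ β₂) y with hp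
  have hp_cont : Continuous p := (hℓ_cont _ _).sub (continuous_dirichletSolution (hℓ_cont _ _))
  set g : ℝ → ℝ → ℝ := fun x y => f (projIcc a b hab.le x) (p x + y) with hg
  have hg_cont : Continuous (Function.uncurry g) :=
    hf_cont.comp_continuous (f := fun q : ℝ × ℝ => ((projIcc a b hab.le q.1 : ℝ), p q.1 + q.2))
      (by fun_prop) fun q => ⟨(projIcc a b hab.le q.1).2, mem_univ _⟩
  have hg_anti : ∀ x, Antitone (g x) := fun x y₂ y₁ hy =>
    hf_mono _ (projIcc a b hab.le x).2 _ _ (add_le_add_right hy _)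
  obtain ⟨u, hu_cont, hu⟩ := exists_eq_dirichletSolution_dirichletSolution hab.le hg_cont hg_anti
  set h : ℝ → ℝ := fun x => g x (u x) with hh
  have hh_cont : Continuous h := hg_cont.comp (by fun_prop : Continuous fun x => (x, u x))
  set U := dirichletSolution a b h with hU
  have hU_cont : Continuous U := continuous_dirichletSolution hh_cont
  set w : ℝ → ℝ := fun y => p y + dirichletSolution a b U y with hw
  obtain ⟨hC, hD₂, hD₄⟩ := contDiff_four_of_hasDerivAt (w := w)
    (w₂ := fun y => ℓ β₁ β₂ y - U y) (w₄ := h)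
    (fun y => ((hℓ_deriv α₁ α₂ y).sub (hasDerivAt_dirichletSolution (hℓ_cont β₁ β₂) y)).add
      (hasDerivAt_dirichletSolution hU_cont y))
    (fun y => ((((hasDerivAt_const y _).sub
      (hasDerivAt_dirichletSolutionDeriv hab (hℓ_cont β₁ β₂) y)).add
      (hasDerivAt_dirichletSolutionDeriv hab hU_cont y)).congr_deriv (by ring)))
    (fun y => (hℓ_deriv β₁ β₂ y).sub (hasDerivAt_dirichletSolution hh_cont y))
    (fun y => ((hasDerivAt_const y _).sub
      (hasDerivAt_dirichletSolutionDeriv hab hh_cont y)).congr_deriv (by ring))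
    hh_cont
  have hwithin : ∀ n : ℕ, n ≤ 4 → ∀ x ∈ Icc a b,
      iteratedDerivWithin n w (Icc a b) x = iteratedDeriv n w x := fun n hn x hx =>
    iteratedDerivWithin_eq_iteratedDeriv (uniqueDiffOn_Icc hab)
      (hC.contDiffAt.of_le (by exact_mod_cast hn)) hx
  refine ⟨w, hC.contDiffOn, fun x hx => ?_, ?_, ?_, ?_, ?_⟩
  · rw [hwithin 4 le_rfl x hx, hD₄]
    simp only [hh, hg, hw, projIcc_of_mem hab.le hx, hu x hx]
  · simp [hw, hp, hℓ_left, dirichletSolution_left]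
  · simp [hw, hp, hℓ_right, dirichletSolution_right]
  · rw [hwithin 2 (by norm_num) a (left_mem_Icc.2 hab.le), hD₂]
    simp [hℓ_left, hU, dirichletSolution_left]
  · rw [hwithin 2 (by norm_num) b (right_mem_Icc.2 hab.le), hD₂]
    simp [hℓ_right, hU, dirichletSolution_right]
end

section
/- Let a < b be real numbers, let α₁, α₂, β₁, β₂ ∈ ℝ, and let f : [a,b] × ℝ → ℝ be continuous and nonincreasing in its second argument (i.e., y₁ ≥ y₂ implies f(x,y₁) ≤ f(x,y₂) for all x ∈ [a,b]). If φ and ψ are both four-times continuously differentiable functions on [a,b] satisfying w⁗(x) = f(x, w(x)) for all x ∈ [a,b] together with the boundary conditions w(a) = α₁, w(b) = α₂, w''(a) = β₁, w''(b) = β₂, then φ = ψ. That is, the BVP possesses at most one solution. -/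
open Set

theorem eqOn_zero_of_hasDerivWithinAt_nonpos {a b : ℝ} (hab : a < b) {g g' : ℝ → ℝ}
    (hg : ∀ x ∈ Icc a b, HasDerivWithinAt g (g' x) (Icc a b) x)
    (hg' : ∀ x ∈ Icc a b, g' x ≤ 0) (hends : g a = g b) :
    ∀ x ∈ Icc a b, g' x = 0 := by
  have hanti : AntitoneOn g (Icc a b) :=
    antitoneOn_of_hasDerivWithinAt_nonpos (convex_Icc a b)
      (fun x hx => (hg x hx).continuousWithinAt)
      (fun x hx => (hg x (interior_subset hx)).mono interior_subset)
      (fun x hx => hg' x (interior_subset hx))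
  have ha : a ∈ Icc a b := left_mem_Icc.2 hab.le
  have hb : b ∈ Icc a b := right_mem_Icc.2 hab.le
  have hconst : ∀ x ∈ Icc a b, g x = g a := fun x hx =>
    le_antisymm (hanti ha hx hx.1) (hends.trans_le (hanti hx hb hx.2))
  intro x hx
  have hzero : HasDerivWithinAt g 0 (Icc a b) x :=
    (hasDerivWithinAt_const x (Icc a b) (g a)).congr hconst (hconst x hx)
  exact (uniqueDiffOn_Icc hab x hx).eq_deriv _ (hg x hx) hzero

theorem eq_zero_of_mul_fourth_deriv_nonpos {a b : ℝ} (hab : a < b) {u u₁ u₂ u₃ u₄ : ℝ → ℝ}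
    (h₀ : ∀ x ∈ Icc a b, HasDerivWithinAt u (u₁ x) (Icc a b) x)
    (h₁ : ∀ x ∈ Icc a b, HasDerivWithinAt u₁ (u₂ x) (Icc a b) x)
    (h₂ : ∀ x ∈ Icc a b, HasDerivWithinAt u₂ (u₃ x) (Icc a b) x)
    (h₃ : ∀ x ∈ Icc a b, HasDerivWithinAt u₃ (u₄ x) (Icc a b) x)
    (hle : ∀ x ∈ Icc a b, u x * u₄ x ≤ 0)
    (hua : u a = 0) (hub : u b = 0) (hu₂a : u₂ a = 0) (hu₂b : u₂ b = 0) :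
    ∀ x ∈ Icc a b, u x = 0 := by
  have hu₂ : ∀ x ∈ Icc a b, u₂ x = 0 := by
    intro x hx
    have h := eqOn_zero_of_hasDerivWithinAt_nonpos hab
      (fun y hy => ((h₀ y hy).mul (h₃ y hy)).sub ((h₁ y hy).mul (h₂ y hy)))
      (fun y hy => by nlinarith [hle y hy, sq_nonneg (u₂ y)])
      (by simp [hua, hub, hu₂a, hu₂b]) x hx
    nlinarith [hle x hx, sq_nonneg (u₂ x)]
  have hu₁ : ∀ x ∈ Icc a b, u₁ x = 0 := by
    intro x hx
    have h := eqOn_zero_of_hasDerivWithinAt_nonpos hab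
      (fun y hy => ((h₀ y hy).mul (h₁ y hy)).neg)
      (fun y hy => by simp only [hu₂ y hy]; nlinarith [sq_nonneg (u₁ y)])
      (by simp [hua, hub]) x hx
    simp only [hu₂ x hx] at h
    nlinarith
  have hanti : AntitoneOn u (Icc a b) :=
    antitoneOn_of_hasDerivWithinAt_nonpos (convex_Icc a b)
      (fun x hx => (h₀ x hx).continuousWithinAt)
      (fun x hx => (h₀ x (interior_subset hx)).mono interior_subset)
      (fun x hx => (hu₁ x (interior_subset hx)).le)
  intro x hx
  exact le_antisymm (hua ▸ hanti (left_mem_Icc.2 hab.le) hx hx.1)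
    (hub ▸ hanti hx (right_mem_Icc.2 hab.le) hx.2)

theorem ContDiffOn.hasDerivWithinAt_iteratedDerivWithin {s : Set ℝ} {w : ℝ → ℝ} {n : ℕ}
    (hw : ContDiffOn ℝ n w s) (hs : UniqueDiffOn ℝ s) {k : ℕ} (hk : k < n) {x : ℝ}
    (hx : x ∈ s) :
    HasDerivWithinAt (iteratedDerivWithin k w s) (iteratedDerivWithin (k + 1) w s x) s x := by
  rw [iteratedDerivWithin_succ]
  exact (hw.differentiableOn_iteratedDerivWithin (by exact_mod_cast hk) hs x hx).hasDerivWithinAt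

/-- **Uniqueness** for the Euler–Bernoulli fourth-order BVP `w⁗ = f(x,w)` on `[a,b]`
with boundary conditions `w a = α₁`, `w b = α₂`, `w'' a = β₁`, `w'' b = β₂`,
when `f` is continuous and nonincreasing in its second argument:
the BVP possesses at most one solution. -/
theorem bvp_uniqueness (a b : ℝ) (hab : a < b) (α₁ α₂ β₁ β₂ : ℝ)
    (f : ℝ → ℝ → ℝ)
    (hf_cont : ContinuousOn (fun p : ℝ × ℝ => f p.1 p.2) (Set.Icc a b ×ˢ Set.univ))
    (hf_mono : ∀ x ∈ Set.Icc a b, ∀ y₁ y₂ : ℝ, y₂ ≤ y₁ → f x y₁ ≤ f x y₂)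
    (φ ψ : ℝ → ℝ)
    (hφ : ContDiffOn ℝ 4 φ (Set.Icc a b))
    (hφode : ∀ x ∈ Set.Icc a b, iteratedDerivWithin 4 φ (Set.Icc a b) x = f x (φ x))
    (hφa : φ a = α₁) (hφb : φ b = α₂)
    (hφa'' : iteratedDerivWithin 2 φ (Set.Icc a b) a = β₁)
    (hφb'' : iteratedDerivWithin 2 φ (Set.Icc a b) b = β₂)
    (hψ : ContDiffOn ℝ 4 ψ (Set.Icc a b))
    (hψode : ∀ x ∈ Set.Icc a b, iteratedDerivWithin 4 ψ (Set.Icc a b) x = f x (ψ x))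
    (hψa : ψ a = α₁) (hψb : ψ b = α₂)
    (hψa'' : iteratedDerivWithin 2 ψ (Set.Icc a b) a = β₁)
    (hψb'' : iteratedDerivWithin 2 ψ (Set.Icc a b) b = β₂) :
    Set.EqOn φ ψ (Set.Icc a b) := by
  have hs := uniqueDiffOn_Icc hab
  have hderiv : ∀ k < 4, ∀ x ∈ Icc a b,
      HasDerivWithinAt
        (iteratedDerivWithin k φ (Icc a b) - iteratedDerivWithin k ψ (Icc a b))
        ((iteratedDerivWithin (k + 1) φ (Icc a b) - iteratedDerivWithin (k + 1) ψ (Icc a b)) x)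
        (Icc a b) x := fun k hk x hx =>
    (ContDiffOn.hasDerivWithinAt_iteratedDerivWithin (n := 4) hφ hs hk hx).sub
      (ContDiffOn.hasDerivWithinAt_iteratedDerivWithin (n := 4) hψ hs hk hx)
  intro x hx
  have h := eq_zero_of_mul_fourth_deriv_nonpos hab
    (hderiv 0 (by norm_num)) (hderiv 1 (by norm_num)) (hderiv 2 (by norm_num))
    (hderiv 3 (by norm_num)) ?_ (by simp [hφa, hψa]) (by simp [hφb, hψb])
    (by simp [hφa'', hψa'']) (by simp [hφb'', hψb'']) x hx
  · simpa [sub_eq_zero] using h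
  · intro y hy
    simp only [Pi.sub_apply, iteratedDerivWithin_zero, Nat.reduceAdd, hφode y hy, hψode y hy]
    rcases le_total (ψ y) (φ y) with hle | hle
    · exact mul_nonpos_of_nonneg_of_nonpos (sub_nonneg.2 hle)
        (sub_nonpos.2 (hf_mono y hy _ _ hle))
    · exact mul_nonpos_of_nonpos_of_nonneg (sub_nonpos.2 hle)
        (sub_nonneg.2 (hf_mono y hy _ _ hle))
end

section
/- Let a < b, let f : [a,b] × ℝ → ℝ be continuous, bounded above by M ∈ ℝ, and nonincreasing in its second argument, and set f_M(x,y) = f(x,y) − M (so f_M ≤ 0). Let G(x,s) = ∫ₐᵇ G̃(x,t) G̃(t,s) dt with G̃ as above, let w̄_M : [a,b] → ℝ be the fourth-degree polynomial satisfying w̄_M⁗ = M, w̄_M(a) = α₁, w̄_M(b) = α₂, w̄_M''(a) = β₁, w̄_M''(b) = β₂, and define the operator 𝓛 on continuous functions by 𝓛[v](x) = w̄_M(x) + ∫ₐᵇ G(x,s) f_M(s, v(s)) ds. Then for all continuous p, q : [a,b] → ℝ: (i) if p(x) ≥ q(x) for all x ∈ [a,b], then 𝓛[p](x) ≤ 𝓛[q](x)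 for all x ∈ [a,b]; and (ii) 𝓛[p](x) ≤ w̄_M(x) for all x ∈ [a,b]. -/
open Set intervalIntegral

/-- The Green's function of the second-order BVP `y'' = h`, `y a = y b = 0`. -/
noncomputable def Gt (a b x s : ℝ) : ℝ :=
  if s ≤ x then -((b - x) * (s - a)) / (b - a) else -((b - s) * (x - a)) / (b - a)

/-- The Green's function `G(x,s) = ∫ₐᵇ G̃(x,t) G̃(t,s) dt` of the fourth-order BVP. -/
noncomputable def Gker (a b x s : ℝ) : ℝ := ∫ t in a..b, Gt a b x t * Gt a b t s

/-- The fourth-degree polynomial `w̄_M` satisfying `w̄_M⁗ = M`, `w̄_M a = α₁`, `w̄_M b = α₂`,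
`w̄_M'' a = β₁`, `w̄_M'' b = β₂`. -/
noncomputable def wbarM (a b α₁ α₂ β₁ β₂ M x : ℝ) : ℝ :=
  α₁ + ((α₂ - α₁) / (b - a) - (β₂ + 2 * β₁) * (b - a) / 6 + M * (b - a) ^ 3 / 24) * (x - a)
    + β₁ / 2 * (x - a) ^ 2
    + ((β₂ - β₁) / (6 * (b - a)) - M * (b - a) / 12) * (x - a) ^ 3
    + M / 24 * (x - a) ^ 4

/-- The operator `𝓛[v] x = w̄_M x + ∫ₐᵇ G(x,s) f_M(s, v s) ds`, where `f_M = f - M`. -/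
noncomputable def Lop (a b α₁ α₂ β₁ β₂ M : ℝ) (f : ℝ → ℝ → ℝ) (v : ℝ → ℝ) (x : ℝ) : ℝ :=
  wbarM a b α₁ α₂ β₁ β₂ M x + ∫ s in a..b, Gker a b x s * (f s (v s) - M)

theorem Gt_eq_min_max (a b x s : ℝ) :
    Gt a b x s = -((b - max x s) * (min x s - a)) / (b - a) := by
  unfold Gt
  split_ifs with h
  · rw [max_eq_left h, min_eq_right h]
  · rw [max_eq_right (le_of_not_ge h), min_eq_left (le_of_not_ge h)]

theorem continuous_Gt (a b : ℝ) : Continuous fun p : ℝ × ℝ => Gt a b p.1 p.2 := by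
  simp only [Gt_eq_min_max]
  fun_prop

theorem Gt_nonpos {a b x s : ℝ} (hab : a < b) (hx : x ∈ Icc a b) (hs : s ∈ Icc a b) :
    Gt a b x s ≤ 0 := by
  rw [Gt_eq_min_max]
  exact div_nonpos_of_nonpos_of_nonneg
    (neg_nonpos.2 (mul_nonneg (sub_nonneg.2 (max_le hx.2 hs.2)) (sub_nonneg.2 (le_min hx.1 hs.1))))
    (sub_nonneg.2 hab.le)

theorem continuous_Gker (a b x : ℝ) : Continuous (Gker a b x) := by
  refine continuous_parametric_intervalIntegral_of_continuous'
    (f := fun s t => Gt a b x t * Gt a b t s) ?_ a b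
  exact ((continuous_Gt a b).comp (continuous_const.prodMk continuous_snd)).mul
    ((continuous_Gt a b).comp (continuous_snd.prodMk continuous_fst))

theorem Gker_nonneg {a b x s : ℝ} (hab : a < b) (hx : x ∈ Icc a b) (hs : s ∈ Icc a b) :
    0 ≤ Gker a b x s :=
  integral_nonneg hab.le fun _ ht =>
    mul_nonneg_of_nonpos_of_nonpos (Gt_nonpos hab hx ht) (Gt_nonpos hab ht hs)

theorem intervalIntegrable_Gker_mul {a b : ℝ} (hab : a < b) (M : ℝ) {f : ℝ → ℝ → ℝ}
    (hf : ContinuousOn (fun p : ℝ × ℝ => f p.1 p.2) (Icc a b ×ˢ univ))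
    {v : ℝ → ℝ} (hv : ContinuousOn v (Icc a b)) (x : ℝ) :
    IntervalIntegrable (fun s => Gker a b x s * (f s (v s) - M)) MeasureTheory.volume a b := by
  refine ContinuousOn.intervalIntegrable_of_Icc hab.le ?_
  have hfv : ContinuousOn (fun s => f s (v s)) (Icc a b) :=
    hf.comp (continuousOn_id.prodMk hv) fun s hs => ⟨hs, mem_univ _⟩
  exact (continuous_Gker a b x).continuousOn.mul (hfv.sub continuousOn_const)

/-- The operator `𝓛` is antitone (`p ≥ q` pointwise on `[a,b]` implies `𝓛[p] ≤ 𝓛[q]`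
pointwise on `[a,b]`) and bounded above by `w̄_M` on `[a,b]`. -/
theorem Lop_antitone_and_le_wbarM (a b : ℝ) (hab : a < b) (α₁ α₂ β₁ β₂ M : ℝ)
    (f : ℝ → ℝ → ℝ)
    (hf_cont : ContinuousOn (fun p : ℝ × ℝ => f p.1 p.2) (Set.Icc a b ×ˢ Set.univ))
    (hf_bdd : ∀ x ∈ Set.Icc a b, ∀ y : ℝ, f x y ≤ M)
    (hf_mono : ∀ x ∈ Set.Icc a b, ∀ y₁ y₂ : ℝ, y₂ ≤ y₁ → f x y₁ ≤ f x y₂)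
    (p q : ℝ → ℝ) (hp : ContinuousOn p (Set.Icc a b)) (hq : ContinuousOn q (Set.Icc a b)) :
    ((∀ x ∈ Set.Icc a b, q x ≤ p x) →
      ∀ x ∈ Set.Icc a b,
        Lop a b α₁ α₂ β₁ β₂ M f p x ≤ Lop a b α₁ α₂ β₁ β₂ M f q x) ∧
    (∀ x ∈ Set.Icc a b, Lop a b α₁ α₂ β₁ β₂ M f p x ≤ wbarM a b α₁ α₂ β₁ β₂ M x) := by
  refine ⟨fun hpq x hx => ?_, fun x hx => ?_⟩
  · refine add_le_add_right (integral_mono_on hab.le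
      (intervalIntegrable_Gker_mul hab M hf_cont hp x)
      (intervalIntegrable_Gker_mul hab M hf_cont hq x) fun s hs => ?_) _
    exact mul_le_mul_of_nonneg_left
      (sub_le_sub_right (hf_mono s hs _ _ (hpq s hs)) M) (Gker_nonneg hab hx hs)
  · have h : 0 ≤ ∫ s in a..b, -(Gker a b x s * (f s (p s) - M)) :=
      integral_nonneg hab.le fun s hs => neg_nonneg.2 <| mul_nonpos_of_nonneg_of_nonpos
        (Gker_nonneg hab hx hs) (sub_nonpos.2 (hf_bdd s hs _))
    rw [integral_neg, neg_nonneg] at h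
    exact add_le_of_nonpos_right h
end

section
/- Let N ∈ ℕ with N ≥ 2 and let 𝓐 be the N×N real pentadiagonal matrix with diagonal entries 𝓐₁₁ = 𝓐_NN = 5 and 𝓐ᵢᵢ = 6 for 2 ≤ i ≤ N−1, first off-diagonal entries equal to −4, second off-diagonal entries equal to 1, and all other entries zero. Then 𝓐 is symmetric, its eigenvalues are exactly λᵢ = 16 sin⁴(iπ/(2(N+1))) for i ∈ {1, …, N}, and 𝓐 is positive definite. -/
open Matrix Real

/-- The `N × N` pentadiagonal finite-difference matrix `𝓐` with diagonal `(5, 6, …, 6, 5)`,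
first off-diagonals `−4`, and second off-diagonals `1`. -/
def penta (N : ℕ) : Matrix (Fin N) (Fin N) ℝ :=
  Matrix.of fun i j =>
    if i = j then (if i.val = 0 ∨ i.val = N - 1 then 5 else 6)
    else if i.val + 1 = j.val ∨ j.val + 1 = i.val then -4
    else if i.val + 2 = j.val ∨ j.val + 2 = i.val then 1
    else 0

/-- The fourth central difference of `sin` sampled with step `2 * t`. -/
theorem sin_fourth_central_diff (a t : ℝ) :
    6 * sin a - 4 * sin (a + 2 * t) - 4 * sin (a - 2 * t) + sin (a + 2 * (2 * t))
      + sin (a - 2 * (2 * t)) = 16 * sin t ^ 4 * sin a := by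
  rw [sin_add, sin_sub, sin_add, sin_sub, cos_two_mul (2 * t), cos_two_mul t]
  have h : cos t ^ 2 = 1 - sin t ^ 2 := cos_sq' t
  rw [h]
  ring

theorem Fin.sum_ite_val_eq {M : Type*} [AddCommMonoid M] (N k : ℕ) (f : ℕ → M) :
    (∑ j : Fin N, if j.val = k then f j.val else 0) = if k < N then f k else 0 := by
  rw [Fin.sum_univ_eq_sum_range (fun j => if j = k then f j else 0) N, Finset.sum_ite_eq']
  simp

theorem Fin.sum_ite_val_add_eq {M : Type*} [AddCommMonoid M] (N k i : ℕ) (hi : i < N)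
    (f : ℕ → M) :
    (∑ j : Fin N, if j.val + k = i then f j.val else 0) = if k ≤ i then f (i - k) else 0 := by
  split_ifs with h
  · have := Fin.sum_ite_val_eq N (i - k) f
    rw [if_pos (by omega)] at this
    rw [← this]
    refine Finset.sum_congr rfl fun j _ => ?_
    congr 1
    exact propext (by omega)
  · exact Finset.sum_eq_zero fun j _ => if_neg (by omega)

theorem penta_mulVec_apply (N : ℕ) (f : ℕ → ℝ) (i : Fin N) :
    (penta N *ᵥ fun j => f j) i =
      (if i.val = 0 ∨ i.val = N - 1 then 5 else 6) * f i
        - 4 * (if i.val + 1 < N then f (i + 1) else 0)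
        - 4 * (if 1 ≤ i.val then f (i - 1) else 0)
        + (if i.val + 2 < N then f (i + 2) else 0)
        + (if 2 ≤ i.val then f (i - 2) else 0) := by
  have hi := Fin.sum_ite_val_eq N i.val f
  rw [if_pos i.isLt] at hi
  rw [← hi, ← Fin.sum_ite_val_eq N (i + 1) f, ← Fin.sum_ite_val_eq N (i + 2) f,
    ← Fin.sum_ite_val_add_eq N 1 i i.isLt,
    ← Fin.sum_ite_val_add_eq N 2 i i.isLt, Finset.mul_sum, Finset.mul_sum, Finset.mul_sum,
    ← Finset.sum_sub_distrib, ← Finset.sum_sub_distrib, ← Finset.sum_add_distrib,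
    ← Finset.sum_add_distrib]
  rw [Matrix.mulVec, dotProduct]
  refine Finset.sum_congr rfl fun j _ => ?_
  simp only [penta, Matrix.of_apply, Fin.ext_iff]
  split_ifs <;> first | omega | ring

theorem penta_mulVec_sin (N k : ℕ) (hN : 2 ≤ N) :
    (penta N *ᵥ fun j => sin ((j.val + 1) * (k * π / (N + 1)))) =
      (16 * sin (k * π / (2 * (N + 1))) ^ 4) •
        fun j : Fin N => sin ((j.val + 1) * (k * π / (N + 1))) := by
  ext i
  rw [penta_mulVec_apply N (fun j => sin ((j + 1) * (k * π / (N + 1)))) i, Pi.smul_apply,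
    smul_eq_mul]
  have hN' : (N : ℝ) + 1 ≠ 0 := by positivity
  obtain ⟨t, ht⟩ : ∃ t, t = k * π / (2 * ((N : ℝ) + 1)) := ⟨_, rfl⟩
  have hθ : k * π / ((N : ℝ) + 1) = 2 * t := by rw [ht]; field_simp
  have hend : ((N : ℝ) + 1) * (2 * t) = k * π := by rw [← hθ]; field_simp
  rw [hθ, ← ht, ← sin_fourth_central_diff]
  obtain ⟨i, hi⟩ := i
  simp only
  have left_up : (if 1 ≤ i then sin (((i - 1 : ℕ) + 1) * (2 * t)) else 0)
      = sin ((i + 1) * (2 * t) - 2 * t) := by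
    split_ifs with h
    · push_cast [h]; ring_nf
    · obtain rfl : i = 0 := by omega
      simp
  have right_up : (if i + 1 < N then sin (((i + 1 : ℕ) + 1) * (2 * t)) else 0)
      = sin ((i + 1) * (2 * t) + 2 * t) := by
    split_ifs with h
    · push_cast; ring_nf
    · obtain rfl : N = i + 1 := by omega
      push_cast at hend
      rw [show ((i : ℝ) + 1) * (2 * t) + 2 * t = k * π by rw [← hend]; ring, sin_nat_mul_pi]
  have left_two : (if 2 ≤ i then sin (((i - 2 : ℕ) + 1) * (2 * t)) else 0)
      = sin ((i + 1) * (2 * t) - 2 * (2 * t))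
        + if i = 0 then sin ((i + 1) * (2 * t)) else 0 := by
    split_ifs with h h' h'
    · omega
    · push_cast [h]; ring_nf
    · subst h'
      rw [show ((0 : ℕ) + 1 : ℝ) * (2 * t) - 2 * (2 * t) = -(((0 : ℕ) + 1 : ℝ) * (2 * t)) by
        push_cast; ring, sin_neg]
      ring
    · obtain rfl : i = 1 := by omega
      rw [show ((1 : ℕ) + 1 : ℝ) * (2 * t) - 2 * (2 * t) = 0 by push_cast; ring]
      simp
  have right_two : (if i + 2 < N then sin (((i + 2 : ℕ) + 1) * (2 * t)) else 0)
      = sin ((i + 1) * (2 * t) + 2 * (2 * t))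
        + if i = N - 1 then sin ((i + 1) * (2 * t)) else 0 := by
    split_ifs with h h' h'
    · omega
    · push_cast; ring_nf
    · obtain rfl : N = i + 1 := by omega
      push_cast at hend
      rw [show ((i : ℝ) + 1) * (2 * t) + 2 * (2 * t) = k * π + 2 * t by rw [← hend]; ring,
        show ((i : ℝ) + 1) * (2 * t) = k * π - 2 * t by rw [← hend]; ring, sin_add, sin_sub,
        sin_nat_mul_pi]
      ring
    · obtain rfl : N = i + 2 := by omega
      push_cast at hend
      rw [show ((i : ℝ) + 1) * (2 * t) + 2 * (2 * t) = k * π by rw [← hend]; ring,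
        sin_nat_mul_pi]
      ring
  rw [left_up, right_up, left_two, right_two]
  split_ifs <;> first | omega | ring

theorem penta_isSymm (N : ℕ) : (penta N).IsSymm := by
  ext i j
  simp only [penta, Matrix.transpose_apply, Matrix.of_apply, Fin.ext_iff]
  split_ifs <;> first | omega | rfl

theorem penta_angle_mem_Ioo {N k : ℕ} (hk : k ∈ Set.Icc 1 N) :
    k * π / (2 * ((N : ℝ) + 1)) ∈ Set.Ioo 0 (π / 2) := by
  obtain ⟨h1, h2⟩ := hk
  have h1' : (1 : ℝ) ≤ k := by exact_mod_cast h1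
  have h2' : (k : ℝ) ≤ N := by exact_mod_cast h2
  refine ⟨by positivity, ?_⟩
  rw [div_lt_div_iff₀ (by positivity) two_pos]
  nlinarith [pi_pos]

theorem penta_eigenvalue_pos {N k : ℕ} (hk : k ∈ Set.Icc 1 N) :
    0 < 16 * sin (k * π / (2 * ((N : ℝ) + 1))) ^ 4 := by
  obtain ⟨h1, h2⟩ := penta_angle_mem_Ioo hk
  have := sin_pos_of_pos_of_lt_pi h1 (by linarith)
  positivity

theorem penta_eigenvalue_injOn (N : ℕ) :
    Set.InjOn (fun i : ℕ => 16 * sin (i * π / (2 * ((N : ℝ) + 1))) ^ 4) (Set.Icc 1 N) := by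
  intro a ha b hb hab
  obtain ⟨ha1, ha2⟩ := penta_angle_mem_Ioo ha
  obtain ⟨hb1, hb2⟩ := penta_angle_mem_Ioo hb
  have hsin := (pow_left_inj₀ (sin_pos_of_pos_of_lt_pi ha1 (by linarith)).le
    (sin_pos_of_pos_of_lt_pi hb1 (by linarith)).le four_ne_zero).mp
    (mul_left_cancel₀ (by norm_num) hab)
  have h := injOn_sin ⟨by linarith, ha2.le⟩ ⟨by linarith, hb2.le⟩ hsin
  have hN : (N : ℝ) + 1 ≠ 0 := by positivity
  have hpi := pi_ne_zero
  field_simp at h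
  exact_mod_cast h

theorem penta_eigenvalue_mem_spectrum {N k : ℕ} (hN : 2 ≤ N) (hk : k ∈ Set.Icc 1 N) :
    16 * sin (k * π / (2 * ((N : ℝ) + 1))) ^ 4 ∈ spectrum ℝ (penta N) := by
  rw [← Matrix.spectrum_toLin', ← Module.End.hasEigenvalue_iff_mem_spectrum]
  refine Module.End.hasEigenvalue_of_hasEigenvector
    (x := fun j : Fin N => sin ((j.val + 1) * (k * π / (N + 1))))
    (Module.End.hasEigenvector_iff.mpr ⟨?_, fun h => ?_⟩)
  · rw [Module.End.mem_eigenspace_iff, Matrix.toLin'_apply, penta_mulVec_sin N k hN]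
  · obtain ⟨h1, h2⟩ := penta_angle_mem_Ioo hk
    have h0 := congrFun h ⟨0, by omega⟩
    have hθ : k * π / ((N : ℝ) + 1) = 2 * (k * π / (2 * ((N : ℝ) + 1))) := by field_simp
    simp only [Nat.cast_zero, zero_add, one_mul, Pi.zero_apply, hθ] at h0
    exact (sin_pos_of_pos_of_lt_pi (by linarith) (by linarith)).ne' h0

theorem Matrix.IsHermitian.ncard_spectrum_le {n : Type*} [Fintype n] [DecidableEq n]
    {A : Matrix n n ℝ} (hA : A.IsHermitian) : (spectrum ℝ A).ncard ≤ Fintype.card n := by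
  rw [hA.spectrum_real_eq_range_eigenvalues, ← Set.image_univ, ← Nat.card_eq_fintype_card,
    ← Set.ncard_univ]
  exact Set.ncard_image_le

/-- `𝓐` is symmetric, its eigenvalues are exactly `16 sin⁴(iπ/(2(N+1)))`, `i ∈ {1,…,N}`,
and `𝓐` is positive definite. -/
theorem penta_symm_spectrum_posDef (N : ℕ) (hN : 2 ≤ N) :
    (penta N).IsSymm ∧
    spectrum ℝ (penta N) =
      (fun i : ℕ => 16 * Real.sin (i * Real.pi / (2 * (N + 1))) ^ 4) '' Set.Icc 1 N ∧
    (penta N).PosDef := by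
  have hH : (penta N).IsHermitian := by
    rw [Matrix.IsHermitian, Matrix.conjTranspose_eq_transpose_of_trivial]
    exact penta_isSymm N
  have hspec : spectrum ℝ (penta N) =
      (fun i : ℕ => 16 * Real.sin (i * Real.pi / (2 * (N + 1))) ^ 4) '' Set.Icc 1 N := by
    refine (Set.eq_of_subset_of_ncard_le ?_ ?_ Matrix.finite_real_spectrum).symm
    · rintro _ ⟨k, hk, rfl⟩
      exact penta_eigenvalue_mem_spectrum hN hk
    · rw [(penta_eigenvalue_injOn N).ncard_image]
      simpa [Set.ncard_eq_toFinset_card'] using hH.ncard_spectrum_le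
  refine ⟨penta_isSymm N, hspec, hH.posDef_iff_eigenvalues_pos.mpr fun i => ?_⟩
  have hmem := hH.eigenvalues_mem_spectrum_real i
  rw [hspec] at hmem
  obtain ⟨k, hk, hki⟩ := hmem
  rw [← hki]
  exact penta_eigenvalue_pos hk
end

section
/- Let a < b, N ∈ ℕ with N ≥ 4, h = (b−a)/(N+1), xᵢ = a + ih for i ∈ {0, …, N+1}, and let f : [a,b] × ℝ → ℝ be continuous, bounded above by M ∈ ℝ, and nonincreasing in its second argument. Let 𝓐 be the N×N symmetric positive definite pentadiagonal matrix with diagonal (5, 6, …, 6, 5), first off-diagonals −4, and second off-diagonals 1, let 𝓑̄ ∈ ℝᴺ be given by 𝓑̄₁ = −β₁h² + 2α₁ − (h⁴/12) f(x₀, α₁), 𝓑̄₂ = −α₁, 𝓑̄ᵢ = 0 for 3 ≤ i ≤ N−2, 𝓑̄_{N−1} = −α₂, 𝓑̄_N = −β₂h² + 2α₂ − (h⁴/12) f(x_{N+1}, α₂), let 𝓜 ∈ ℝᴺ have all entries M, and let 𝓕_M : ℝᴺ → ℝᴺ be given by [𝓕_M(Y)]ᵢ = f(xᵢ, Yᵢ)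 − M. Then the equation 𝓦 = 𝓐⁻¹𝓑̄ + h⁴ 𝓐⁻¹(𝓜 + 𝓕_M(𝓦)) has exactly one solution 𝓦 ∈ ℝᴺ. -/
open Matrix Set

/-- The boundary-data vector `𝓑̄` of the finite-difference discretization (indices are
`0`-based: entry `i` of the paper corresponds to `i - 1` here). Here `h = (b-a)/(N+1)`,
`x₀ = a` and `x_{N+1} = b`. -/
noncomputable def Bvec (a b α₁ α₂ β₁ β₂ : ℝ) (f : ℝ → ℝ → ℝ) (N : ℕ) : Fin N → ℝ :=
  fun i =>
    if i.val = 0 then -β₁ * ((b - a) / (N + 1)) ^ 2 + 2 * α₁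
        - ((b - a) / (N + 1)) ^ 4 / 12 * f a α₁
    else if i.val = N - 1 then -β₂ * ((b - a) / (N + 1)) ^ 2 + 2 * α₂
        - ((b - a) / (N + 1)) ^ 4 / 12 * f b α₂
    else if i.val = 1 then -α₁
    else if i.val = N - 2 then -α₂
    else 0

/-- The tridiagonal second-difference matrix, with diagonal `2` and off-diagonals `-1`. -/
def secondDiff (N : ℕ) : Matrix (Fin N) (Fin N) ℝ :=
  Matrix.of fun i j =>
    if i = j then 2 else if i.val + 1 = j.val ∨ j.val + 1 = i.val then -1 else 0

theorem sum_secondDiff_mul {N : ℕ} (i : Fin N) (g : Fin N → ℝ) :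
    ∑ j, secondDiff N i j * g j =
      2 * g i - (if h : i.val + 1 < N then g ⟨i.val + 1, h⟩ else 0) -
        (if 0 < i.val then g ⟨i.val - 1, by omega⟩ else 0) := by
  have h₁ : (if h : i.val + 1 < N then g ⟨i.val + 1, h⟩ else 0) =
      ∑ j : Fin N, if i.val + 1 = j.val then g j else 0 := by
    split_ifs with h
    · rw [Finset.sum_eq_single ⟨i.val + 1, h⟩] <;> simp +contextual [Fin.ext_iff, eq_comm]
    · exact (Finset.sum_eq_zero fun j _ => if_neg (by omega)).symm
  have h₂ : (if 0 < i.val then g ⟨i.val - 1, by omega⟩ else 0) =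
      ∑ j : Fin N, if j.val + 1 = i.val then g j else 0 := by
    split_ifs with h
    · rw [Finset.sum_eq_single ⟨i.val - 1, by omega⟩]
      · rw [if_pos (by simp only; omega)]
      · intro j _ hj
        refine if_neg fun h' => hj (Fin.ext ?_)
        simp only
        omega
      · simp
    · exact (Finset.sum_eq_zero fun j _ => if_neg (by omega)).symm
  have h₃ : 2 * g i = ∑ j : Fin N, if i = j then 2 * g j else 0 := by simp
  rw [h₁, h₂, h₃, ← Finset.sum_sub_distrib, ← Finset.sum_sub_distrib]
  refine Finset.sum_congr rfl fun j _ => ?_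
  simp only [secondDiff, Matrix.of_apply, Fin.ext_iff]
  split_ifs <;> first | omega | ring

theorem secondDiff_transpose (N : ℕ) : (secondDiff N)ᵀ = secondDiff N := by
  ext i j
  simp only [secondDiff, Matrix.transpose_apply, Matrix.of_apply, Fin.ext_iff]
  split_ifs <;> first | omega | rfl

theorem penta_eq_transpose_mul {N : ℕ} (hN : 2 ≤ N) :
    penta N = (secondDiff N)ᵀ * secondDiff N := by
  ext i j
  rw [secondDiff_transpose, Matrix.mul_apply, sum_secondDiff_mul i fun k => secondDiff N k j]
  simp only [secondDiff, penta, Matrix.of_apply, Fin.ext_iff]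
  split_ifs <;> first | omega | norm_num

theorem secondDiff_mulVec_injective (N : ℕ) : Function.Injective (secondDiff N).mulVec := by
  refine (injective_iff_map_eq_zero (secondDiff N).mulVecLin).2 fun x hx => ?_
  have hrow (i : Fin N) := (sum_secondDiff_mul i x).symm.trans (congrFun hx i)
  simp only [Pi.zero_apply] at hrow
  rcases Nat.eq_zero_or_pos N with rfl | hN
  · exact Subsingleton.elim _ _
  have hlin (k : ℕ) (hk : k < N) : x ⟨k, hk⟩ = (k + 1) * x ⟨0, hN⟩ := by
    induction k using Nat.strong_induction_on with
    | _ k ih =>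
      match k with
      | 0 => simp
      | 1 =>
        have := hrow ⟨0, hN⟩
        simp [hk] at this
        push_cast
        linarith
      | k + 2 =>
        have := hrow ⟨k + 1, by omega⟩
        simp [hk] at this
        rw [ih k (by omega) (by omega), ih (k + 1) (by omega) (by omega)] at this
        push_cast at this ⊢
        linarith
  have h0 : x ⟨0, hN⟩ = 0 := by
    have := hrow ⟨N - 1, by omega⟩
    obtain ⟨n, rfl⟩ : ∃ n, N = n + 1 := ⟨N - 1, by omega⟩
    rw [hlin] at this
    rcases n with _ | n
    · simpa using this
    · simp [hlin n (by omega)] at this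
      have h : ((n : ℝ) + 3) * x 0 = 0 := by linarith
      exact (mul_eq_zero.1 h).resolve_left (by positivity)
  ext ⟨k, hk⟩
  simp [hlin k hk, h0]

theorem norm_sq_le_dotProduct_self {ι : Type*} [Fintype ι] (v : ι → ℝ) :
    ‖v‖ ^ 2 ≤ v ⬝ᵥ v := by
  have hnn : 0 ≤ v ⬝ᵥ v := Finset.sum_nonneg fun i _ => mul_self_nonneg _
  refine (Real.le_sqrt (norm_nonneg v) hnn).1 ?_
  refine (pi_norm_le_iff_of_nonneg (Real.sqrt_nonneg _)).2 fun i => ?_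
  refine Real.le_sqrt_of_sq_le ?_
  rw [Real.norm_eq_abs, sq_abs, sq]
  exact Finset.single_le_sum (f := fun i => v i * v i) (fun i _ => mul_self_nonneg _)
    (Finset.mem_univ i)

theorem Antitone.intervalIntegral_le_mul {g : ℝ → ℝ} (hg : Antitone g) (w : ℝ) :
    ∫ t in (0 : ℝ)..w, g t ≤ w * g 0 := by
  have hint (u v : ℝ) : IntervalIntegrable g MeasureTheory.volume u v :=
    hg.intervalIntegrable
  rcases le_total 0 w with hw | hw
  · have := intervalIntegral.integral_mono_on hw (hint 0 w) intervalIntegrable_const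
      (fun t ht => hg ht.1)
    simpa using this
  · have := intervalIntegral.integral_mono_on hw intervalIntegrable_const (hint w 0)
      (fun t ht => hg ht.2)
    rw [intervalIntegral.integral_symm]
    simp at this
    linarith

section Monotone

variable {ι : Type*} [Fintype ι] {D : Matrix ι ι ℝ} {g : ι → ℝ → ℝ}

theorem dotProduct_transpose_mul_mulVec (D : Matrix ι ι ℝ) (u v : ι → ℝ) :
    u ⬝ᵥ ((Dᵀ * D) *ᵥ v) = (D *ᵥ u) ⬝ᵥ (D *ᵥ v) := by
  rw [← Matrix.mulVec_mulVec, Matrix.dotProduct_mulVec, Matrix.vecMul_transpose]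

/-- The energy whose critical points solve `Dᵀ D W = g(W)`. -/
noncomputable def energy (D : Matrix ι ι ℝ) (g : ι → ℝ → ℝ) (W : ι → ℝ) : ℝ :=
  (D *ᵥ W) ⬝ᵥ (D *ᵥ W) / 2 - ∑ i, ∫ t in (0 : ℝ)..W i, g i t

theorem continuous_energy (hg : ∀ i, Continuous (g i)) : Continuous (energy D g) := by
  have h (i : ι) : Continuous fun w : ℝ => ∫ t in (0 : ℝ)..w, g i t :=
    intervalIntegral.continuous_primitive (fun u v => (hg i).intervalIntegrable u v) 0
  have hD : Continuous fun W : ι → ℝ => D *ᵥ W := continuous_const.matrix_mulVec continuous_id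
  exact ((hD.dotProduct hD).div_const 2).sub
    (continuous_finsetSum _ fun i _ => (h i).comp (continuous_apply i))

theorem tendsto_energy_cocompact (hD : Function.Injective D.mulVec) (hg : ∀ i, Antitone (g i)) :
    Filter.Tendsto (energy D g) (Filter.cocompact _) Filter.atTop := by
  obtain ⟨K, hK, hK'⟩ := D.mulVecLin.exists_antilipschitzWith (LinearMap.ker_eq_bot.2 hD)
  have hnorm (W : ι → ℝ) : ‖W‖ ≤ K * ‖D *ᵥ W‖ := by
    simpa using hK'.le_mul_dist W 0
  have hK0 : (0 : ℝ) < K := hK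
  set C : ℝ := ∑ i, |g i 0|
  have hlow (W : ι → ℝ) : ‖W‖ * (‖W‖ * (1 / (2 * K ^ 2)) - C) ≤ energy D g W := by
    have h₁ : ∑ i, ∫ t in (0 : ℝ)..W i, g i t ≤ ‖W‖ * C := by
      rw [Finset.mul_sum]
      refine Finset.sum_le_sum fun i _ => ((hg i).intervalIntegral_le_mul _).trans ?_
      refine (le_abs_self _).trans ?_
      rw [abs_mul]
      exact mul_le_mul_of_nonneg_right (norm_le_pi_norm W i) (abs_nonneg _)
    have h₂ : ‖W‖ ^ 2 ≤ K ^ 2 * ((D *ᵥ W) ⬝ᵥ (D *ᵥ W)) := by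
      calc ‖W‖ ^ 2 ≤ (K * ‖D *ᵥ W‖) ^ 2 := by gcongr; exact hnorm W
        _ = K ^ 2 * ‖D *ᵥ W‖ ^ 2 := by ring
        _ ≤ _ := by gcongr; exact norm_sq_le_dotProduct_self _
    have h₃ : ‖W‖ ^ 2 * (1 / (2 * K ^ 2)) ≤ (D *ᵥ W) ⬝ᵥ (D *ᵥ W) / 2 := by
      rw [mul_one_div, div_le_iff₀ (by positivity)]
      linarith
    unfold energy
    linarith
  refine Filter.tendsto_atTop_mono hlow ?_
  have hn := tendsto_norm_cocompact_atTop (E := ι → ℝ)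
  refine hn.atTop_mul_atTop₀ ?_
  exact Filter.tendsto_atTop_add_const_right _ _ (hn.atTop_mul_const (by positivity))

theorem hasDerivAt_energy_line (hg : ∀ i, Continuous (g i)) (W v : ι → ℝ) :
    HasDerivAt (fun t : ℝ => energy D g (W + t • v))
      (v ⬝ᵥ ((Dᵀ * D) *ᵥ W - fun i => g i (W i))) 0 := by
  have hline (i : ι) : HasDerivAt (fun t : ℝ => W i + t * v i) (v i) 0 := by
    simpa using ((hasDerivAt_id (0 : ℝ)).mul_const (v i)).const_add (W i)
  have hint (i : ι) : HasDerivAt (fun t : ℝ => ∫ s in (0 : ℝ)..(W i + t * v i), g i s)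
      (g i (W i) * v i) 0 := by
    have h := intervalIntegral.integral_hasDerivAt_right ((hg i).intervalIntegrable 0 (W i))
      ((hg i).stronglyMeasurableAtFilter _ _) (hg i).continuousAt
    refine HasDerivAt.comp (0 : ℝ) (h₂ := fun w => ∫ s in (0 : ℝ)..w, g i s) ?_ (hline i)
    simpa using h
  have hquad : HasDerivAt (fun t : ℝ => (D *ᵥ W) ⬝ᵥ (D *ᵥ W) / 2 +
      (t * ((D *ᵥ v) ⬝ᵥ (D *ᵥ W)) + t ^ 2 * ((D *ᵥ v) ⬝ᵥ (D *ᵥ v) / 2)))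
      ((D *ᵥ v) ⬝ᵥ (D *ᵥ W)) 0 := by
    have h₁ := (hasDerivAt_id (0 : ℝ)).mul_const ((D *ᵥ v) ⬝ᵥ (D *ᵥ W))
    have h₂ := (hasDerivAt_pow 2 (0 : ℝ)).mul_const ((D *ᵥ v) ⬝ᵥ (D *ᵥ v) / 2)
    simpa using (h₁.add h₂).const_add ((D *ᵥ W) ⬝ᵥ (D *ᵥ W) / 2)
  have hsum := hquad.sub (HasDerivAt.fun_sum (u := Finset.univ) fun i _ => hint i)
  have hval : v ⬝ᵥ ((Dᵀ * D) *ᵥ W - fun i => g i (W i)) =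
      (D *ᵥ v) ⬝ᵥ (D *ᵥ W) - ∑ i, g i (W i) * v i := by
    rw [dotProduct_sub, dotProduct_transpose_mul_mulVec]
    simp only [dotProduct, mul_comm]
  rw [hval]
  refine hsum.congr_of_eventuallyEq (Filter.Eventually.of_forall fun t => ?_)
  simp only [energy, Pi.sub_apply, Pi.add_apply, Pi.smul_apply, smul_eq_mul, Matrix.mulVec_add,
    Matrix.mulVec_smul, add_dotProduct, dotProduct_add, smul_dotProduct, dotProduct_smul]
  rw [dotProduct_comm (D *ᵥ W) (D *ᵥ v)]
  ring

/-- A positive definite linear system with a continuous, nonincreasing, diagonal nonlinearity has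
exactly one solution. -/
theorem existsUnique_transpose_mul_mulVec_eq (hD : Function.Injective D.mulVec)
    (hcont : ∀ i, Continuous (g i)) (hanti : ∀ i, Antitone (g i)) :
    ∃! W : ι → ℝ, (Dᵀ * D) *ᵥ W = fun i => g i (W i) := by
  refine existsUnique_of_exists_of_unique ?_ fun W V hW hV => ?_
  · obtain ⟨W, hW⟩ := (continuous_energy (D := D) hcont).exists_forall_le
      (tendsto_energy_cocompact hD hanti)
    refine ⟨W, sub_eq_zero.1 (dotProduct_self_eq_zero.1 ?_)⟩
    refine IsLocalMin.hasDerivAt_eq_zero (Filter.Eventually.of_forall fun t => ?_)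
      (hasDerivAt_energy_line hcont W ((Dᵀ * D) *ᵥ W - fun i => g i (W i)))
    simpa using hW _
  · have hle : (D *ᵥ (W - V)) ⬝ᵥ (D *ᵥ (W - V)) ≤ 0 := by
      rw [← dotProduct_transpose_mul_mulVec, Matrix.mulVec_sub, hW, hV]
      refine Finset.sum_nonpos fun i _ => ?_
      simp only [Pi.sub_apply]
      rcases le_total (W i) (V i) with h | h
      · exact mul_nonpos_of_nonpos_of_nonneg (sub_nonpos.2 h) (sub_nonneg.2 (hanti i h))
      · exact mul_nonpos_of_nonneg_of_nonpos (sub_nonneg.2 h) (sub_nonpos.2 (hanti i h))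
    have hz : D *ᵥ (W - V) = 0 := dotProduct_self_eq_zero.1
      (hle.antisymm (Finset.sum_nonneg fun i _ => mul_self_nonneg _))
    rw [Matrix.mulVec_sub, sub_eq_zero] at hz
    exact hD hz

end Monotone

/-- The discrete fourth-order BVP `𝓦 = 𝓐⁻¹𝓑̄ + h⁴𝓐⁻¹(𝓜 + 𝓕_M(𝓦))` has exactly one
solution, when `f` is continuous, bounded above by `M`, and nonincreasing in its second
argument. -/
theorem discrete_bvp_existence_uniqueness (a b : ℝ) (hab : a < b) (α₁ α₂ β₁ β₂ M : ℝ)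
    (N : ℕ) (hN : 4 ≤ N) (f : ℝ → ℝ → ℝ)
    (hf_cont : ContinuousOn (fun p : ℝ × ℝ => f p.1 p.2) (Set.Icc a b ×ˢ Set.univ))
    (hf_bdd : ∀ x ∈ Set.Icc a b, ∀ y : ℝ, f x y ≤ M)
    (hf_mono : ∀ x ∈ Set.Icc a b, ∀ y₁ y₂ : ℝ, y₂ ≤ y₁ → f x y₁ ≤ f x y₂) :
    ∃! W : Fin N → ℝ,
      W = (penta N)⁻¹ *ᵥ Bvec a b α₁ α₂ β₁ β₂ f N +
        ((b - a) / (N + 1)) ^ 4 •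
          ((penta N)⁻¹ *ᵥ
            (fun i : Fin N => M + (f (a + (i.val + 1) * ((b - a) / (N + 1))) (W i) - M))) := by
  set h : ℝ := (b - a) / (N + 1)
  have hh : 0 < h := div_pos (sub_pos.2 hab) (by positivity)
  have hmem (i : Fin N) : a + (i.val + 1) * h ∈ Set.Icc a b := by
    have hNh : (N + 1 : ℝ) * h = b - a := mul_div_cancel₀ _ (by positivity)
    have hi : (i.val : ℝ) + 1 ≤ N + 1 := by exact_mod_cast Nat.succ_le_succ i.2.le
    have := mul_le_mul_of_nonneg_right hi hh.le
    exact ⟨le_add_of_nonneg_right (by positivity), by linarith⟩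
  have hunit : IsUnit (penta N) := by
    rw [penta_eq_transpose_mul (by omega), secondDiff_transpose]
    have := Matrix.mulVec_injective_iff_isUnit.1 (secondDiff_mulVec_injective N)
    exact this.mul this
  have hdet : IsUnit (penta N).det := (Matrix.isUnit_iff_isUnit_det _).1 hunit
  set B := Bvec a b α₁ α₂ β₁ β₂ f N
  refine (existsUnique_congr fun W => ?_).1 (existsUnique_transpose_mul_mulVec_eq
    (g := fun i w => B i + h ^ 4 * f (a + (i.val + 1) * h) w)
    (secondDiff_mulVec_injective N) (fun i => ?_) fun i w₁ w₂ hw => ?_)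
  · rw [← penta_eq_transpose_mul (by omega), ← Matrix.mulVec_smul, ← Matrix.mulVec_add]
    have hrhs : (B + h ^ 4 • fun i : Fin N => M + (f (a + (i.val + 1) * h) (W i) - M)) =
        fun i => B i + h ^ 4 * f (a + (i.val + 1) * h) (W i) := by
      ext i
      simp
    rw [hrhs]
    constructor
    · intro hW
      rw [← hW, Matrix.mulVec_mulVec, Matrix.nonsing_inv_mul _ hdet, Matrix.one_mulVec]
    · intro hW
      conv_lhs => rw [hW]
      rw [Matrix.mulVec_mulVec, Matrix.mul_nonsing_inv _ hdet, Matrix.one_mulVec]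
  · have hc : Continuous fun w => f (a + (i.val + 1) * h) w :=
      hf_cont.comp_continuous (f := fun w : ℝ => (a + (i.val + 1) * h, w)) (by fun_prop)
        fun w => ⟨hmem i, Set.mem_univ w⟩
    exact continuous_const.add (continuous_const.mul hc)
  · exact add_le_add_right (mul_le_mul_of_nonneg_left (hf_mono _ (hmem i) _ _ hw)
      (by positivity)) _
end
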